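/- Let v* = (C, ζ, z, α, ξ) be a feasible point of the BHO-SVM MPEC with C > 0, (Mα)_i ≠ 0 for every i ∈ {1,…,s}, and K_(Λ3⁺, Λ3⁺) positive definite. Suppose |I_GH4| = 1 and |I_GH3| = 0. Set A₄ = K_(Λ3ᶜ, Λ3⁺)·(K_(Λ3⁺, Λ3⁺))⁻¹ (with A₄ = 0 if Λ3⁺ = ∅) and â₄ = K_(Λ3ᶜ, Λ3ᶜ∪Λu)·1 − A₄·K_(Λ3⁺, Λ3ᶜ∪Λu)·1 ∈ ℝ. Then MPEC-LICQ holds at v* if and only if â₄ ≠ 0. -/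

import Mathlib

/-!
STATEMENT 15: At a feasible point of the BHO-SVM MPEC with C > 0, (Mα)ᵢ ≠ 0 for all i,
K_(Λ3⁺,Λ3⁺) positive definite, |I_GH4| = 1 (I_GH4 = {i0} = Λ3ᶜ) and |I_GH3| = 0,
MPEC-LICQ holds at v* iff â₄ ≠ 0, where
â₄ = K_(Λ3ᶜ,Λ3ᶜ∪Λu)·1 − K_(Λ3ᶜ,Λ3⁺)·(K_(Λ3⁺,Λ3⁺))⁻¹·K_(Λ3⁺,Λ3ᶜ∪Λu)·1.
-/

noncomputable section

/-- Index of the `2s+2q` complementarity constraint pairs of the BHO-SVM MPEC: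
`s` pairs `(ζᵢ, (Mα+z)ᵢ)`, `s` pairs `(zᵢ, 1-ζᵢ)`, `q` pairs `(αᵢ, (Kα-1+ξ)ᵢ)`,
`q` pairs `(ξᵢ, C-αᵢ)`. -/
abbrev BIdx (s q : ℕ) := Fin s ⊕ Fin s ⊕ Fin q ⊕ Fin q

/-- Variable space of the BHO-SVM MPEC: `v = (C, ζ, z, α, ξ)`. -/
abbrev BVec (s q : ℕ) := ℝ × (Fin s → ℝ) × (Fin s → ℝ) × (Fin q → ℝ) × (Fin q → ℝ)

/-- `H(v) = (ζ, z, α, ξ)`. -/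
def bH {s q : ℕ} : BIdx s q → BVec s q → ℝ
  | Sum.inl i, v => v.2.1 i
  | Sum.inr (Sum.inl i), v => v.2.2.1 i
  | Sum.inr (Sum.inr (Sum.inl i)), v => v.2.2.2.1 i
  | Sum.inr (Sum.inr (Sum.inr i)), v => v.2.2.2.2 i

/-- `G(v) = (Mα+z, 1-ζ, Kα-1+ξ, C·1-α)`. -/
def bG {s q : ℕ} (M : Matrix (Fin s) (Fin q) ℝ) (K : Matrix (Fin q) (Fin q) ℝ) :
    BIdx s q → BVec s q → ℝ
  | Sum.inl i, v => M.mulVec v.2.2.2.1 i + v.2.2.1 i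
  | Sum.inr (Sum.inl i), v => 1 - v.2.1 i
  | Sum.inr (Sum.inr (Sum.inl i)), v => K.mulVec v.2.2.2.1 i - 1 + v.2.2.2.2 i
  | Sum.inr (Sum.inr (Sum.inr i)), v => v.1 - v.2.2.2.1 i

/-- `∇H_i(v)`: the gradients of the (affine) functions `H_i`, as vectors of `BVec s q`. -/
def bGradH {s q : ℕ} : BIdx s q → BVec s q
  | Sum.inl i => (0, Pi.single i 1, 0, 0, 0)
  | Sum.inr (Sum.inl i) => (0, 0, Pi.single i 1, 0, 0)
  | Sum.inr (Sum.inr (Sum.inl i)) => (0, 0, 0, Pi.single i 1, 0)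
  | Sum.inr (Sum.inr (Sum.inr i)) => (0, 0, 0, 0, Pi.single i 1)

/-- `∇G_i(v)`: the gradients of the (affine) functions `G_i`, as vectors of `BVec s q`. -/
def bGradG {s q : ℕ} (M : Matrix (Fin s) (Fin q) ℝ) (K : Matrix (Fin q) (Fin q) ℝ) :
    BIdx s q → BVec s q
  | Sum.inl i => (0, 0, Pi.single i 1, fun j => M i j, 0)
  | Sum.inr (Sum.inl i) => (0, -Pi.single i 1, 0, 0, 0)
  | Sum.inr (Sum.inr (Sum.inl i)) => (0, 0, 0, fun j => K i j, Pi.single i 1)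
  | Sum.inr (Sum.inr (Sum.inr i)) => (1, 0, 0, -Pi.single i 1, 0)

/-- The principal submatrix `K_(Λ,Λ)` is positive definite. -/
def posDefOn {q : ℕ} (K : Matrix (Fin q) (Fin q) ℝ) (Λ : Set (Fin q)) : Prop :=
  haveI : Fintype ↥Λ := Fintype.ofFinite ↥Λ
  Matrix.PosDef (Matrix.of fun i j : ↥Λ => K i.1 j.1)

/-- `âhat K i0 Λp Λcol = K_({i0}, Λcol)·1 − (K_({i0}, Λp)·(K_(Λp,Λp))⁻¹)·K_(Λp, Λcol)·1`.
If `Λp = ∅` the second term vanishes (the convention `A = 0`). -/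
def ahat {q : ℕ} (K : Matrix (Fin q) (Fin q) ℝ) (i0 : Fin q)
    (Λp Λcol : Set (Fin q)) : ℝ :=
  haveI : Fintype ↥Λp := Fintype.ofFinite ↥Λp
  haveI : Fintype ↥Λcol := Fintype.ofFinite ↥Λcol
  haveI : DecidableEq ↥Λp := Classical.decEq _
  (∑ j : ↥Λcol, K i0 j.1) -
    ∑ j : ↥Λcol, ∑ k : ↥Λp,
      Matrix.vecMul (fun t : ↥Λp => K i0 t.1)
        (Matrix.of fun a b : ↥Λp => K a.1 b.1)⁻¹ k * K k.1 j.1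

theorem aux_li {ι V : Type*} [Fintype ι] [AddCommGroup V] [Module ℝ V]
    (P Q : ι → Prop) (f h : ι → V) :
    LinearIndependent ℝ (Sum.elim (fun i : {x // P x} => f i.1) (fun i : {x // Q x} => h i.1)) ↔
    ∀ a b : ι → ℝ, (∀ x, ¬ P x → a x = 0) → (∀ x, ¬ Q x → b x = 0) →
      ∑ x, a x • f x + ∑ x, b x • h x = 0 → (∀ x, a x = 0) ∧ (∀ x, b x = 0) := by
  classical
  have key : ∀ (P : ι → Prop) (a : ι → ℝ) (f : ι → V), (∀ x, ¬ P x → a x = 0) →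
      ∑ x : {x // P x}, a x.1 • f x.1 = ∑ x, a x • f x := by
    intro P a f hP
    rw [← Finset.sum_subtype (p := P) (Finset.univ.filter P) (by simp) (fun x => a x • f x)]
    · rw [Finset.sum_filter]
      · refine Finset.sum_congr rfl fun x _ => ?_
        by_cases hx : P x
        · simp [hx]
        · simp [hx, hP x hx]
  rw [Fintype.linearIndependent_iff]
  constructor
  · intro H a b ha hb hs
    have := H (Sum.elim (fun i => a i.1) (fun i => b i.1)) (by
      rw [Fintype.sum_sum_type]
      simp only [Sum.elim_inl, Sum.elim_inr]
      rw [key P a f ha, key Q b h hb, hs])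
    constructor
    · intro x
      by_cases hx : P x
      · exact this (Sum.inl ⟨x, hx⟩)
      · exact ha x hx
    · intro x
      by_cases hx : Q x
      · exact this (Sum.inr ⟨x, hx⟩)
      · exact hb x hx
  · intro H g hg
    have := H (fun x => if hx : P x then g (Sum.inl ⟨x, hx⟩) else 0)
      (fun x => if hx : Q x then g (Sum.inr ⟨x, hx⟩) else 0)
      (fun x hx => by simp [hx]) (fun x hx => by simp [hx]) (by
        rw [← key P _ f (fun x hx => by simp [hx]), ← key Q _ h (fun x hx => by simp [hx])]
        rw [Fintype.sum_sum_type] at hg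
        simpa [Subtype.prop] using hg)
    rintro (⟨x, hx⟩ | ⟨x, hx⟩)
    · simpa [hx] using this.1 x
    · simpa [hx] using this.2 x

theorem aux_sumG {s q : ℕ} (M : Matrix (Fin s) (Fin q) ℝ) (K : Matrix (Fin q) (Fin q) ℝ)
    (a : BIdx s q → ℝ) :
    ∑ x, a x • bGradG M K x =
      (∑ i, a (.inr (.inr (.inr i))), fun i => - a (.inr (.inl i)), fun i => a (.inl i),
        fun j => ∑ i, a (.inl i) * M i j + ∑ i, a (.inr (.inr (.inl i))) * K i j
          - a (.inr (.inr (.inr j))),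
        fun i => a (.inr (.inr (.inl i)))) := by
  simp only [Fintype.sum_sum_type, bGradG]
  refine Prod.ext ?_ (Prod.ext ?_ (Prod.ext ?_ (Prod.ext ?_ ?_)))
  · simp [Prod.fst_sum, Prod.snd_sum]
  all_goals
    funext j
    simp [Prod.fst_sum, Prod.snd_sum, Finset.sum_apply, Pi.single_apply]
  try ring

theorem aux_sumH {s q : ℕ} (b : BIdx s q → ℝ) :
    ∑ x, b x • bGradH x =
      ((0 : ℝ), fun i => b (.inl i), fun i => b (.inr (.inl i)),
        fun i => b (.inr (.inr (.inl i))),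
        fun i => b (.inr (.inr (.inr i)))) := by
  simp only [Fintype.sum_sum_type, bGradH]
  refine Prod.ext ?_ (Prod.ext ?_ (Prod.ext ?_ (Prod.ext ?_ ?_)))
  · simp [Prod.fst_sum, Prod.snd_sum]
  all_goals
    funext j
    simp [Prod.fst_sum, Prod.snd_sum, Finset.sum_apply, Pi.single_apply]

open Classical in
theorem aux_sum_sub {q : ℕ} (Λ : Set (Fin q)) (I : Fintype Λ) (f : Fin q → ℝ) :
    ∑ k : Λ, f k.1 = ∑ k, if k ∈ Λ then f k else 0 := by
  rw [← Finset.sum_filter]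
  rw [← Finset.sum_subtype (F := I) (p := fun x => x ∈ Λ) (Finset.univ.filter (· ∈ Λ)) (by simp) f]

open Classical in
theorem aux_ahat {q : ℕ} (K : Matrix (Fin q) (Fin q) ℝ) (i0 : Fin q) (Λp Λc : Set (Fin q))
    (hpd : posDefOn K Λp) :
    ∃ e : Fin q → ℝ, (∀ i, i ∉ Λp → e i = 0) ∧
      (∀ j ∈ Λp, ∑ i, e i * K i j = K i0 j) ∧
      (ahat K i0 Λp Λc = ∑ j, if j ∈ Λc then K i0 j - ∑ i, e i * K i j else 0) ∧
      ∀ x : Fin q → ℝ, (∀ i, i ∉ Λp → x i = 0) → (∀ j ∈ Λp, ∑ i, x i * K i j = 0) → x = 0 := by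
  letI : Fintype ↥Λp := Fintype.ofFinite ↥Λp
  letI : Fintype ↥Λc := Fintype.ofFinite ↥Λc
  letI : DecidableEq ↥Λp := Classical.decEq _
  set N : Matrix Λp Λp ℝ := Matrix.of fun i j : ↥Λp => K i.1 j.1 with hN
  have hp : N.PosDef := hpd
  have hu : IsUnit N.det := hp.det_pos.ne'.isUnit
  set w := Matrix.vecMul (fun t : ↥Λp => K i0 t.1) N⁻¹ with hw
  have hsum : ∀ (x : Fin q → ℝ) (j : Fin q), (∀ i, i ∉ Λp → x i = 0) →
      ∑ i, x i * K i j = ∑ i : Λp, x i.1 * K i.1 j := by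
    intro x j hx
    rw [aux_sum_sub Λp _ (fun i => x i * K i j)]
    refine Finset.sum_congr rfl fun i _ => ?_
    by_cases hi : i ∈ Λp
    · simp [hi]
    · simp [hi, hx i hi]
  let e : Fin q → ℝ := fun i => if hi : i ∈ Λp then w ⟨i, hi⟩ else 0
  have he : ∀ i, i ∉ Λp → e i = 0 := fun i hi => by simp [e, hi]
  have hew : ∀ i : Λp, e i.1 = w i := fun i => by simp [e]
  refine ⟨e, he, ?_, ?_, ?_⟩
  · intro j hj
    rw [hsum e j he]
    have h1 : Matrix.vecMul w N = fun t : ↥Λp => K i0 t.1 := by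
      rw [hw, Matrix.vecMul_vecMul, Matrix.nonsing_inv_mul _ hu, Matrix.vecMul_one]
    have h2 := congrFun h1 ⟨j, hj⟩
    simp only [Matrix.vecMul, dotProduct, hN, Matrix.of_apply] at h2
    simpa only [hew] using h2
  · have h3 : ahat K i0 Λp Λc = (∑ j : ↥Λc, K i0 j.1) -
        ∑ j : ↥Λc, ∑ k : ↥Λp, w k * K k.1 j.1 := rfl
    rw [h3, ← Finset.sum_sub_distrib,
      ← aux_sum_sub Λc _ (fun j => K i0 j - ∑ i, e i * K i j)]
    refine Finset.sum_congr rfl fun j _ => ?_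
    rw [hsum e _ he]
    simp only [hew]
  · intro x hx hxK
    have h1 : Matrix.vecMul (fun i : Λp => x i.1) N = 0 := by
      funext j
      have := hxK j.1 j.2
      rw [hsum x _ hx] at this
      simpa [Matrix.vecMul, dotProduct, hN] using this
    have h2 : (fun i : Λp => x i.1) = 0 := by
      have := congrArg (fun y => Matrix.vecMul y N⁻¹) h1
      simpa [Matrix.vecMul_vecMul, Matrix.mul_nonsing_inv _ hu] using this
    funext i
    by_cases hi : i ∈ Λp
    · exact congrFun h2 ⟨i, hi⟩
    · exact hx i hi

theorem bho_licq_iff_ahat4_ne_zero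
    (s q r : ℕ) (hs : 0 < s) (hq : 0 < q) (hr : 0 < r)
    (A : Matrix (Fin s) (Fin r) ℝ) (B : Matrix (Fin q) (Fin r) ℝ)
    (M : Matrix (Fin s) (Fin q) ℝ) (K : Matrix (Fin q) (Fin q) ℝ)
    (hM : M = A * B.transpose) (hK : K = B * B.transpose)
    (C : ℝ) (ζ z : Fin s → ℝ) (α ξ : Fin q → ℝ)
    -- feasibility of v* = (C, ζ, z, α, ξ)
    (hζ : ∀ i, 0 ≤ ζ i) (hG1 : ∀ i, 0 ≤ M.mulVec α i + z i)
    (hc1 : ∀ i, ζ i * (M.mulVec α i + z i) = 0)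
    (hz : ∀ i, 0 ≤ z i) (hG2 : ∀ i, 0 ≤ 1 - ζ i) (hc2 : ∀ i, z i * (1 - ζ i) = 0)
    (hα : ∀ i, 0 ≤ α i) (hG3 : ∀ i, 0 ≤ K.mulVec α i - 1 + ξ i)
    (hc3 : ∀ i, α i * (K.mulVec α i - 1 + ξ i) = 0)
    (hξ : ∀ i, 0 ≤ ξ i) (hG4 : ∀ i, 0 ≤ C - α i) (hc4 : ∀ i, ξ i * (C - α i) = 0)
    -- standing assumptions
    (hC : 0 < C) (hMα : ∀ i, M.mulVec α i ≠ 0)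
    -- K_(Λ3⁺, Λ3⁺) positive definite
    (hpd : posDefOn K
      {i : Fin q | 0 < α i ∧ α i < C ∧ K.mulVec α i - 1 + ξ i = 0 ∧ ξ i = 0})
    -- |I_GH4| = 1, with I_GH4 = {i0} (under feasibility and C > 0, Λ3ᶜ = I_GH4)
    (i0 : Fin q)
    (hGH4 : {i : Fin q | ξ i = 0 ∧ α i = C} = {i0})
    -- |I_GH3| = 0
    (hGH3 : {i : Fin q | α i = 0 ∧ K.mulVec α i - 1 + ξ i = 0} = ∅) :
    -- MPEC-LICQ holds at v* iff â₄ ≠ 0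
    (LinearIndependent ℝ
      (Sum.elim
        (fun i : {idx : BIdx s q // bG M K idx (C, ζ, z, α, ξ) = 0} => bGradG M K i.1)
        (fun i : {idx : BIdx s q // bH idx (C, ζ, z, α, ξ) = 0} => bGradH i.1)))
    ↔
    ahat K i0
      {i : Fin q | 0 < α i ∧ α i < C ∧ K.mulVec α i - 1 + ξ i = 0 ∧ ξ i = 0}  -- Λ3⁺
      ({i : Fin q | α i = C ∧ K.mulVec α i - 1 + ξ i = 0 ∧ ξ i = 0} ∪          -- Λ3ᶜ
       {i : Fin q | α i = C ∧ K.mulVec α i - 1 + ξ i = 0 ∧ 0 < ξ i})           -- Λu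
      ≠ 0 := by
  classical
  rw [aux_li (fun idx => bG M K idx (C, ζ, z, α, ξ) = 0) (fun idx => bH idx (C, ζ, z, α, ξ) = 0)]
  set Λp : Set (Fin q) :=
    {i : Fin q | 0 < α i ∧ α i < C ∧ K.mulVec α i - 1 + ξ i = 0 ∧ ξ i = 0} with hΛp
  set Λc : Set (Fin q) := ({i : Fin q | α i = C ∧ K.mulVec α i - 1 + ξ i = 0 ∧ ξ i = 0} ∪
       {i : Fin q | α i = C ∧ K.mulVec α i - 1 + ξ i = 0 ∧ 0 < ξ i}) with hΛc
  obtain ⟨e, he, heK, hah, huniq⟩ := aux_ahat K i0 Λp Λc hpd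
  have hi0 : ξ i0 = 0 ∧ α i0 = C := by
    have : i0 ∈ {i : Fin q | ξ i = 0 ∧ α i = C} := by rw [hGH4]; rfl
    exact this
  have hi0' : ∀ i, ξ i = 0 → α i = C → i = i0 := by
    intro i h1 h2
    have : i ∈ ({i0} : Set (Fin q)) := by rw [← hGH4]; exact ⟨h1, h2⟩
    exact this
  have hno3 : ∀ i, α i = 0 → K.mulVec α i - 1 + ξ i ≠ 0 := by
    intro i h1 h2
    have : i ∈ (∅ : Set (Fin q)) := by rw [← hGH3]; exact ⟨h1, h2⟩
    exact this
  have hmc : ∀ i, i ∈ Λc ↔ α i = C := by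
    intro i
    simp only [hΛc, Set.mem_union, Set.mem_ofPred_eq]
    constructor
    · rintro (h | h) <;> exact h.1
    · intro h
      have h3 : K.mulVec α i - 1 + ξ i = 0 := by
        rcases mul_eq_zero.1 (hc3 i) with h' | h'
        · linarith
        · exact h'
      rcases (hξ i).eq_or_lt with h' | h'
      · exact Or.inl ⟨h, h3, h'.symm⟩
      · exact Or.inr ⟨h, h3, h'⟩
  have hmp : ∀ i, i ∈ Λp ↔ (α i ≠ 0 ∧ α i ≠ C) := by
    intro i
    simp only [hΛp, Set.mem_ofPred_eq]
    constructor
    · rintro ⟨h1, h2, -, -⟩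
      exact ⟨h1.ne', h2.ne⟩
    · rintro ⟨h1, h2⟩
      refine ⟨lt_of_le_of_ne (hα i) (Ne.symm h1), lt_of_le_of_ne (by linarith [hG4 i]) h2, ?_, ?_⟩
      · exact (mul_eq_zero.1 (hc3 i)).resolve_left h1
      · exact (mul_eq_zero.1 (hc4 i)).resolve_right (fun h => h2 (by linarith))
  have hi0p : i0 ∉ Λp := fun h => ((hmp i0).1 h).2 hi0.2
  have hlin : ∀ (t : ℝ) (j : Fin q), ∑ i, (t * ((Pi.single i0 1 : Fin q → ℝ) i - e i)) * K i j
      = t * (K i0 j - ∑ i, e i * K i j) := by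
    intro t j
    simp only [mul_assoc, ← Finset.mul_sum, sub_mul, Finset.sum_sub_distrib]
    simp [Pi.single_apply]
  rw [hah]
  constructor
  · intro H h0
    let a3 : Fin q → ℝ := fun i => 1 * ((Pi.single i0 1 : Fin q → ℝ) i - e i)
    let u : Fin q → ℝ := fun j => K i0 j - ∑ i, e i * K i j
    let a : BIdx s q → ℝ := Sum.elim (fun _ => 0) (Sum.elim (fun _ => 0) (Sum.elim a3
      (fun j => if j ∈ Λc then u j else 0)))
    let b : BIdx s q → ℝ := Sum.elim (fun _ => 0) (Sum.elim (fun _ => 0) (Sum.elim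
      (fun j => if α j = 0 then - u j else 0) (fun j => - a3 j)))
    have hsupp : ∀ i, a3 i ≠ 0 → i = i0 ∨ i ∈ Λp := by
      intro i hi
      by_contra! hcon
      apply hi
      simp [a3, he i hcon.2, hcon.1]
    have hu0 : ∀ j ∈ Λp, u j = 0 := fun j hj => by simp [u, heK j hj]
    have hres := (H a b ?_ ?_ ?_).1 (.inr (.inr (.inl i0)))
    · simp [a, a3, he i0 hi0p] at hres
    · rintro (i | i | i | i) hx
      · rfl
      · rfl
      · by_contra hne
        rcases hsupp i hne with rfl | h
        · exact hx ((mul_eq_zero.1 (hc3 i)).resolve_left (by linarith [hi0.2] : α i ≠ 0))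
        · exact hx h.2.2.1
      · have : i ∉ Λc := fun h => hx (by simp [bG, (hmc i).1 h])
        simp [a, this]
    · rintro (i | i | i | i) hx
      · rfl
      · rfl
      · have : α i ≠ 0 := hx
        simp [b, this]
      · by_contra hne
        rcases hsupp i (fun h => hne (by simp [b, h])) with rfl | h
        · exact hx hi0.1
        · exact hx h.2.2.2
    · rw [aux_sumG, aux_sumH]
      refine Prod.ext ?_ (Prod.ext ?_ (Prod.ext ?_ (Prod.ext ?_ ?_)))
      · simp only [a, u, Sum.elim_inr, Prod.fst_add, add_zero, Prod.fst_zero]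
        convert h0
      · funext j; simp [a, b]
      · funext j; simp [a, b]
      · funext j
        have := hlin 1 j
        have h2 : ∑ i, a3 i * K i j = u j := by
          rw [one_mul] at this; exact this
        simp only [a, b, Sum.elim_inl, Sum.elim_inr, Prod.snd_add, Prod.fst_add, Pi.add_apply,
          zero_mul, Finset.sum_const_zero, h2, Prod.snd_zero, Prod.fst_zero, Pi.zero_apply, hmc]
        by_cases hj : α j = 0
        · simp [hj, hC.ne]
        · by_cases hj' : α j = C
          · simp [hj', hC.ne']
          · simp [hj, hj', hu0 j ((hmp j).2 ⟨hj, hj'⟩)]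
      · funext j; simp [a, b]
  · intro hne a b ha hb hs
    rw [aux_sumG, aux_sumH] at hs
    simp only [Prod.mk_add_mk, Prod.mk_eq_zero] at hs
    obtain ⟨e1, e2, e3, e4, e5⟩ := hs
    have e2 : ∀ i, - a (.inr (.inl i)) + b (.inl i) = 0 := fun i => congrFun e2 i
    have e3 : ∀ i, a (.inl i) + b (.inr (.inl i)) = 0 := fun i => congrFun e3 i
    have e4 : ∀ j, ∑ i, a (.inl i) * M i j + ∑ i, a (.inr (.inr (.inl i))) * K i j
          - a (.inr (.inr (.inr j))) + b (.inr (.inr (.inl j))) = 0 := fun j => congrFun e4 j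
    have e5 : ∀ i, a (.inr (.inr (.inl i))) + b (.inr (.inr (.inr i))) = 0 :=
      fun i => congrFun e5 i
    have z2 : ∀ i, a (.inr (.inl i)) = 0 ∧ b (.inl i) = 0 := by
      intro i
      by_cases h : ζ i = 0
      · have := ha (.inr (.inl i)) (by simp [bG, h])
        exact ⟨this, by linarith [e2 i]⟩
      · have := hb (.inl i) h
        exact ⟨by linarith [e2 i], this⟩
    have z1 : ∀ i, a (.inl i) = 0 ∧ b (.inr (.inl i)) = 0 := by
      intro i
      by_cases h : z i = 0
      · have := ha (.inl i) (by simpa [bG, h] using hMα i)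
        exact ⟨this, by linarith [e3 i]⟩
      · have := hb (.inr (.inl i)) h
        exact ⟨by linarith [e3 i], this⟩
    have e4 : ∀ j, ∑ i, a (.inr (.inr (.inl i))) * K i j
          - a (.inr (.inr (.inr j))) + b (.inr (.inr (.inl j))) = 0 := fun j => by
      have := e4 j
      simpa [z1] using this
    have s3 : ∀ i, i ≠ i0 → i ∉ Λp → a (.inr (.inr (.inl i))) = 0 := by
      intro i h1 h2
      by_cases h : α i = 0
      · exact ha _ (hno3 i h)
      · have hC' : α i = C := by
          by_contra h'
          exact h2 ((hmp i).2 ⟨h, h'⟩)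
        have := hb (.inr (.inr (.inr i))) (fun h' => h1 (hi0' i h' hC'))
        linarith [e5 i]
    have s4 : ∀ i, i ∉ Λc → a (.inr (.inr (.inr i))) = 0 := by
      intro i h
      refine ha _ (fun h' => h ((hmc i).2 ?_))
      have : C - α i = 0 := h'
      linarith
    have s3b : ∀ i, α i ≠ 0 → b (.inr (.inr (.inl i))) = 0 := fun i h => hb _ h
    set t := a (.inr (.inr (.inl i0))) with ht
    have e4p : ∀ j ∈ Λp, ∑ i, a (.inr (.inr (.inl i))) * K i j = 0 := by
      intro j hj
      have h1 := (hmp j).1 hj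
      have h2 := s4 j (fun h => h1.2 ((hmc j).1 h))
      have h3 := s3b j h1.1
      linarith [e4 j]
    have hx := huniq (fun i => a (.inr (.inr (.inl i))) - t * ((Pi.single i0 1 : Fin q → ℝ) i - e i))
      (by
        intro i hi
        by_cases h : i = i0
        · subst h; simp [he i hi, ht]
        · simp [s3 i h hi, he i hi, h])
      (by
        intro j hj
        simp only [sub_mul (a (.inr (.inr (.inl _)))), Finset.sum_sub_distrib, hlin, heK j hj,
          e4p j hj]
        simp)
    have hx' : ∀ i, a (.inr (.inr (.inl i))) = t * ((Pi.single i0 1 : Fin q → ℝ) i - e i) :=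
      fun i => sub_eq_zero.1 (congrFun hx i)
    have hS : ∀ j, ∑ i, a (.inr (.inr (.inl i))) * K i j = t * (K i0 j - ∑ i, e i * K i j) := by
      intro j
      rw [← hlin t j]
      exact Finset.sum_congr rfl fun i _ => by rw [hx' i]
    have h4 : ∀ j, a (.inr (.inr (.inr j))) =
        t * (if j ∈ Λc then K i0 j - ∑ i, e i * K i j else 0) := by
      intro j
      by_cases hj : j ∈ Λc
      · have h3 := s3b j (by rw [(hmc j).1 hj]; exact hC.ne')
        rw [if_pos hj, ← hS j]
        linarith [e4 j]
      · rw [if_neg hj, s4 j hj, mul_zero]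
    have ht0 : t = 0 := by
      have h5 : t * (∑ j, if j ∈ Λc then K i0 j - ∑ i, e i * K i j else 0) = 0 := by
        rw [Finset.mul_sum, ← Finset.sum_congr rfl fun j _ => h4 j]
        simpa using e1
      exact (mul_eq_zero.1 h5).resolve_right (by convert hne)
    have z3 : ∀ i, a (.inr (.inr (.inl i))) = 0 := fun i => by rw [hx' i, ht0, zero_mul]
    have z4 : ∀ i, a (.inr (.inr (.inr i))) = 0 := fun i => by rw [h4 i, ht0, zero_mul]
    constructor
    · rintro (i | i | i | i)
      · exact (z1 i).1
      · exact (z2 i).1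
      · exact z3 i
      · exact z4 i
    · rintro (i | i | i | i)
      · exact (z2 i).2
      · exact (z1 i).2
      · have := e4 i
        rw [hS i, ht0, z4 i] at this
        linarith
      · linarith [e5 i, z3 i]
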